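/- Let n ≥ 3 and let S be a sequence over the cyclic group C_n of order n such that 0 is not a term of S, |S| ≥ n − 1, and N_0(S) = 2^{|S|−n+1}. Then n − 1 ≤ |S| ≤ n and S = a^{|S|} (the element a repeated |S| times) for some generator a of C_n. -/

import Mathlib

/-- `NSub S g` is the number of subsequences (sub-multisets, counted with the
multiplicity of their appearance in `S`) of the sequence `S` with sum `g`. -/
def NSub {G : Type*} [AddCommGroup G] [DecidableEq G] (S : Multiset G) (g : G) : ℕ :=
  (S.powerset.filter (fun T => T.sum = g)).card

/-- The Davenport constant of `G`: the smallest positive integer `ℓ` such that every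
sequence over `G` of length at least `ℓ` has a nonempty zero-sum subsequence. -/
noncomputable def Davenport (G : Type*) [AddCommGroup G] : ℕ :=
  sInf {ℓ : ℕ | 0 < ℓ ∧ ∀ S : Multiset G, ℓ ≤ Multiset.card S →
    ∃ T : Multiset G, T ≤ S ∧ T ≠ 0 ∧ T.sum = 0}

/-- `ESet S = {g ∈ G : N_g(S) = 2 ^ (|S| - D(G) + 1)}`. -/
def ESet {G : Type*} [AddCommGroup G] [DecidableEq G] (S : Multiset G) : Set G :=
  {g | NSub S g = 2 ^ (Multiset.card S + 1 - Davenport G)}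

/-- A minimal zero-sum sequence: nonempty, zero-sum, and every nonempty proper
subsequence has nonzero sum. -/
def IsMinZeroSum {G : Type*} [AddCommGroup G] (T : Multiset G) : Prop :=
  T ≠ 0 ∧ T.sum = 0 ∧ ∀ U : Multiset G, U ≤ T → U ≠ 0 → U ≠ T → U.sum ≠ 0

section SubsequenceSums

variable {G : Type*} [AddCommGroup G] [DecidableEq G]

theorem NSub_cons (g : G) (S : Multiset G) (h : G) :
    NSub (g ::ₘ S) h = NSub S h + NSub S (h - g) := by
  simp only [NSub, Multiset.powerset_cons, Multiset.filter_add, Multiset.card_add,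
    Multiset.filter_map, Multiset.card_map]
  congr 3
  funext T
  simp [eq_sub_iff_add_eq, add_comm]

theorem one_le_NSub_zero (S : Multiset G) : 1 ≤ NSub S 0 :=
  Multiset.card_pos_iff_exists_mem.2 ⟨0, by simp⟩

/-- Negating the terms of a subsequence translates the subsequence sums. -/
theorem NSub_map_neg_add (U V : Multiset G) (h : G) :
    NSub (U.map (fun x => -x) + V) h = NSub (U + V) (U.sum + h) := by
  induction U using Multiset.induction_on generalizing h with
  | empty => simp
  | cons u U ih =>
    rw [Multiset.map_cons, Multiset.cons_add, Multiset.cons_add, NSub_cons, NSub_cons, ih, ih,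
      Multiset.sum_cons, add_comm]
    congr 2 <;> abel

theorem choose_le_NSub_replicate (a : G) (m k : ℕ) :
    m.choose k ≤ NSub (Multiset.replicate m a) (k • a) := by
  induction m generalizing k with
  | zero =>
    cases k with
    | zero => simpa using one_le_NSub_zero (0 : Multiset G)
    | succ k => simp
  | succ m ih =>
    cases k with
    | zero => simpa using one_le_NSub_zero (Multiset.replicate (m + 1) a)
    | succ k =>
      rw [Multiset.replicate_succ, NSub_cons, Nat.choose_succ_succ, add_comm]
      have hk : (k + 1) • a - a = k • a := by rw [succ_nsmul, add_sub_cancel_right]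
      rw [hk]
      exact Nat.add_le_add (ih _) (ih _)

omit [DecidableEq G] in
theorem take_sum_injOn {l : List G}
    (hl : ∀ T : Multiset G, T ≤ (l : Multiset G) → T ≠ 0 → T.sum ≠ 0) :
    Set.InjOn (fun i => (l.take i).sum) (Finset.range (l.length + 1) : Set ℕ) := by
  have key : ∀ i j, i < j → j ≤ l.length → (l.take i).sum ≠ (l.take j).sum := by
    intro i j hij hj h
    obtain ⟨d, rfl⟩ := Nat.exists_eq_add_of_lt hij
    rw [add_assoc, List.take_add, List.sum_append, left_eq_add] at h
    refine hl (((l.drop i).take (d + 1) : List G) : Multiset G) ?_ ?_ (by simpa using h)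
    · exact ((List.take_sublist _ _).trans (List.drop_sublist _ _)).subperm
    · intro h'
      have := congrArg Multiset.card h'
      simp at this
      omega
  intro i hi j hj h
  simp only [Finset.coe_range, Set.mem_Iio] at hi hj
  rcases lt_trichotomy i j with hij | hij | hij
  · exact (key i j hij (by omega) h).elim
  · exact hij
  · exact (key j i hij (by omega) h.symm).elim

variable [Fintype G]

omit [DecidableEq G] in
theorem exists_zero_sum_of_card_le {S : Multiset G} (hS : Fintype.card G ≤ Multiset.card S) :
    ∃ T ≤ S, T ≠ 0 ∧ T.sum = 0 := by
  by_contra! hfree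
  induction S using Quotient.inductionOn with | _ l
  have := Finset.card_le_card_of_injOn (t := Finset.univ) _ (by simp)
    (take_sum_injOn (l := l) hfree)
  rw [Finset.card_range, Finset.card_univ] at this
  simp at hS
  omega

theorem exists_cons_of_card_le {S : Multiset G} (hS : Fintype.card G ≤ Multiset.card S) :
    ∃ g R, S = g ::ₘ R ∧ ∃ R' : Multiset G, Multiset.card R' = Multiset.card R ∧
      NSub R (0 - g) = NSub R' 0 := by
  obtain ⟨T, hTS, hT0, hT⟩ := exists_zero_sum_of_card_le hS
  obtain ⟨g, hg⟩ := Multiset.exists_mem_of_ne_zero hT0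
  obtain ⟨U, rfl⟩ := Multiset.exists_cons_of_mem hg
  obtain ⟨V, rfl⟩ := Multiset.le_iff_exists_add.1 hTS
  refine ⟨g, U + V, Multiset.cons_add _ _ _, U.map (fun x => -x) + V, by simp, ?_⟩
  rw [NSub_map_neg_add]
  congr 1
  rw [Multiset.sum_cons] at hT
  rw [zero_sub, add_zero, neg_eq_iff_add_eq_zero, hT]

theorem two_pow_le_NSub_zero (S : Multiset G) :
    2 ^ (Multiset.card S + 1 - Fintype.card G) ≤ NSub S 0 := by
  induction hm : Multiset.card S generalizing S with
  | zero =>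
    have := Fintype.card_pos (α := G)
    rw [Nat.sub_eq_zero_of_le (by omega)]
    exact one_le_NSub_zero S
  | succ m ih =>
    rcases lt_or_ge (m + 1) (Fintype.card G) with h | h
    · rw [Nat.sub_eq_zero_of_le (by omega)]
      exact one_le_NSub_zero S
    · obtain ⟨g, R, rfl, R', hR', hN⟩ := exists_cons_of_card_le (hm ▸ h)
      rw [Multiset.card_cons, Nat.add_right_cancel_iff] at hm
      rw [NSub_cons, hN, Nat.sub_add_comm h, pow_succ]
      have h₁ := ih R hm
      have h₂ := ih R' (hR'.trans hm)
      omega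

omit [DecidableEq G] in
theorem head_eq_of_zero_sum_free {x y : G} {R : Multiset G}
    (hcard : Multiset.card (x ::ₘ y ::ₘ R) + 1 = Fintype.card G)
    (hfree : ∀ T ≤ x ::ₘ y ::ₘ R, T ≠ 0 → T.sum ≠ 0) : x = y := by
  induction R using Quotient.inductionOn with | _ l
  have hcard' : l.length + 3 = Fintype.card G := by simpa using hcard
  have hsurj := Finset.surj_on_of_inj_on_of_card_le
    (s := Finset.range ((x :: y :: l).length + 1)) (t := (Finset.univ : Finset G))
    (fun i _ => ((x :: y :: l).take i).sum) (by simp)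
    (fun i j hi hj h => take_sum_injOn (l := x :: y :: l) hfree hi hj h)
    (by rw [Finset.card_range, Finset.card_univ]; simp; omega) y (Finset.mem_univ y)
  obtain ⟨i, hi, h⟩ := hsurj
  match i with
  | 0 =>
    refine (hfree {y} ?_ (by simp) (by simpa using h)).elim
    simp
  | 1 => simpa using h.symm
  | i + 2 =>
    refine (hfree (x ::ₘ ((l.take i : List G) : Multiset G)) ?_ (by simp) ?_).elim
    · rw [Multiset.cons_le_cons_iff]
      exact (Multiset.coe_le.2 (List.take_sublist i l).subperm).trans (Multiset.le_cons_self _ _)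
    · simp only [List.take_succ_cons, List.sum_cons] at h
      rw [Multiset.sum_cons, Multiset.sum_coe]
      rw [add_left_comm, left_eq_add] at h
      exact h

omit [DecidableEq G] in
theorem eq_replicate_of_zero_sum_free {S : Multiset G} (hG : 3 ≤ Fintype.card G)
    (hcard : Multiset.card S + 1 = Fintype.card G)
    (hfree : ∀ T ≤ S, T ≠ 0 → T.sum ≠ 0) :
    ∃ a : G, addOrderOf a = Fintype.card G ∧ S = Multiset.replicate (Multiset.card S) a := by
  obtain ⟨a, ha⟩ := Multiset.card_pos_iff_exists_mem.1 (show 0 < Multiset.card S by omega)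
  obtain ⟨R, rfl⟩ := Multiset.exists_cons_of_mem ha
  have hrep : a ::ₘ R = Multiset.replicate (Multiset.card (a ::ₘ R)) a := by
    refine Multiset.eq_replicate_card.2 fun b hb => ?_
    rcases Multiset.mem_cons.1 hb with rfl | hb
    · rfl
    · obtain ⟨Q, rfl⟩ := Multiset.exists_cons_of_mem hb
      exact (head_eq_of_zero_sum_free hcard hfree).symm
  refine ⟨a, le_antisymm addOrderOf_le_card_univ ?_, hrep⟩
  by_contra! hlt
  refine hfree (Multiset.replicate (addOrderOf a) a) ?_ ?_ ?_
  · rw [hrep]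
    exact (Multiset.replicate_le_replicate a).2 (by omega)
  · intro h
    have h' := congrArg Multiset.card h
    rw [Multiset.card_replicate, Multiset.card_zero] at h'
    exact (addOrderOf_pos a).ne' h'
  · rw [Multiset.sum_replicate, addOrderOf_nsmul_eq_zero]

omit [Fintype G] in
theorem sum_ne_zero_of_NSub_zero_eq_one {S : Multiset G} (hN : NSub S 0 = 1) :
    ∀ T ≤ S, T ≠ 0 → T.sum ≠ 0 := by
  intro T hTS hT0 hT
  obtain ⟨X, hX⟩ := Multiset.card_eq_one.1 hN
  have h₁ : T ∈ S.powerset.filter (fun T => T.sum = 0) := by simp [hTS, hT]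
  have h₂ : 0 ∈ S.powerset.filter (fun T => T.sum = 0) := by simp
  rw [hX, Multiset.mem_singleton] at h₁ h₂
  exact hT0 (h₁.trans h₂.symm)

omit [DecidableEq G] in
theorem exists_nsmul_eq {a g : G} (ha : addOrderOf a = Fintype.card G) (hg : g ≠ 0) :
    ∃ k, 0 < k ∧ k < Fintype.card G ∧ k • a = g := by
  classical
  have hmem : g ∈ AddSubgroup.zmultiples a := by
    have : AddSubgroup.zmultiples a = ⊤ := by
      rw [← AddSubgroup.card_eq_iff_eq_top, Nat.card_zmultiples, ha, Nat.card_eq_fintype_card]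
    simp [this]
  rw [mem_zmultiples_iff_mem_range_addOrderOf, Finset.mem_image] at hmem
  obtain ⟨k, hk, rfl⟩ := hmem
  refine ⟨k, Nat.pos_of_ne_zero ?_, ha ▸ Finset.mem_range.1 hk, rfl⟩
  rintro rfl
  simp at hg

theorem eq_replicate_of_NSub_zero_eq (hG : 3 ≤ Fintype.card G) (S : Multiset G)
    (h0 : (0 : G) ∉ S) (hlen : Fintype.card G ≤ Multiset.card S + 1)
    (hN : NSub S 0 = 2 ^ (Multiset.card S + 1 - Fintype.card G)) :
    Multiset.card S ≤ Fintype.card G ∧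
      ∃ a : G, addOrderOf a = Fintype.card G ∧ S = Multiset.replicate (Multiset.card S) a := by
  induction hm : Multiset.card S generalizing S with
  | zero => omega
  | succ m ih =>
    rcases Nat.lt_or_ge (m + 1) (Fintype.card G) with hlt | hge
    · rw [Nat.sub_eq_zero_of_le (by omega), pow_zero] at hN
      obtain ⟨a, ha⟩ := eq_replicate_of_zero_sum_free hG (by omega)
        (sum_ne_zero_of_NSub_zero_eq_one hN)
      exact ⟨by omega, a, hm ▸ ha⟩
    · obtain ⟨g, R, rfl, R', hR', hN'⟩ := exists_cons_of_card_le (hm ▸ hge)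
      rw [hm, Nat.sub_add_comm hge, pow_succ, NSub_cons] at hN
      rw [Multiset.card_cons, Nat.add_right_cancel_iff] at hm
      have h₁ := two_pow_le_NSub_zero R
      have h₂ := two_pow_le_NSub_zero R'
      rw [hR', ← hN'] at h₂
      rw [hm] at h₁ h₂
      have hg : g ≠ 0 := fun h => h0 (by simp [h])
      obtain ⟨hle, a, ha, hrep⟩ := ih R (fun h => h0 (Multiset.mem_cons_of_mem h)) (by omega)
        (by rw [hm]; omega) hm
      obtain ⟨k, hk0, hk, hka⟩ := exists_nsmul_eq ha (neg_ne_zero.2 hg)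
      have hchoose := choose_le_NSub_replicate a m k
      rw [← hrep, hka, ← zero_sub] at hchoose
      rcases Nat.lt_or_ge m (Fintype.card G) with hm' | hm'
      · have hmk : m + 1 - Fintype.card G = 0 := by omega
        rw [hmk] at hN h₁ h₂
        have hc : m.choose k = 1 := by
          have := Nat.choose_pos (show k ≤ m by omega)
          omega
        have hkm : k = m := by
          rcases Nat.choose_eq_one_iff.1 hc with h | h <;> omega
        refine ⟨by omega, a, ha, ?_⟩
        rw [hrep, Multiset.replicate_succ]
        congr 1
        have hz : (m + 1) • a = 0 := by
          rw [show m + 1 = addOrderOf a by omega, addOrderOf_nsmul_eq_zero]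
        rw [succ_nsmul, ← hkm, hka, neg_add_eq_zero] at hz
        exact hz
      · exfalso
        have hmk : m + 1 - Fintype.card G = 1 := by omega
        rw [hmk] at hN h₁ h₂
        obtain ⟨m, rfl⟩ := Nat.exists_eq_succ_of_ne_zero (show m ≠ 0 by omega)
        obtain ⟨k, rfl⟩ := Nat.exists_eq_succ_of_ne_zero hk0.ne'
        have hp₁ := Nat.choose_pos (show k ≤ m by omega)
        have hp₂ := Nat.choose_pos (show k + 1 ≤ m by omega)
        rw [Nat.succ_eq_add_one, Nat.succ_eq_add_one, Nat.choose_succ_succ'] at hchoose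
        have hc₁ : m.choose k = 1 := by omega
        have hc₂ : m.choose (k + 1) = 1 := by omega
        rcases Nat.choose_eq_one_iff.1 hc₁ with h | h <;>
          rcases Nat.choose_eq_one_iff.1 hc₂ with h' | h' <;> omega

end SubsequenceSums

theorem stmt7 (n : ℕ) (hn : 3 ≤ n) (S : Multiset (ZMod n))
    (h0 : (0 : ZMod n) ∉ S) (hlen : n - 1 ≤ Multiset.card S)
    (hN : NSub S 0 = 2 ^ (Multiset.card S + 1 - n)) :
    n - 1 ≤ Multiset.card S ∧ Multiset.card S ≤ n ∧
      ∃ a : ZMod n, addOrderOf a = n ∧ S = Multiset.replicate (Multiset.card S) a := by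
  have : NeZero n := ⟨by omega⟩
  have hc := ZMod.card n
  have h := eq_replicate_of_NSub_zero_eq (by omega) S h0 (by omega) (by rw [hc]; exact hN)
  rw [hc] at h
  exact ⟨hlen, h⟩
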